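/- Let v* = 1/2 + 1/(2·sqrt(3)) and let x* > 0 be the unique real number with v(x*) = v*. Then for every continuously differentiable h : [0,∞) → ℝ with h and h' bounded, ∫_0^∞ (h(x) - h(x*))² w(x)² dx ≤ (1/k²) ∫_0^∞ h'(x)² w(x)² dx. -/

import Mathlib

open Real MeasureTheory

/-- The wave number `k = sqrt(b/(2ν))`. -/
noncomputable def waveK (ν b : ℝ) : ℝ := Real.sqrt (b / (2 * ν))

/-- The travelling wave profile `v(x) = (1 + exp(-k x))⁻¹`. -/
noncomputable def twProfile (ν b : ℝ) (x : ℝ) : ℝ :=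
  (1 + Real.exp (-(waveK ν b) * x))⁻¹

/-- `w = v' = k v (1 - v)`. -/
noncomputable def twW (ν b : ℝ) (x : ℝ) : ℝ :=
  waveK ν b * twProfile ν b x * (1 - twProfile ν b x)

open Filter Topology

section TravellingWave

variable {ν b : ℝ}

lemma waveK_pos (hν : 0 < ν) (hb : 0 < b) : 0 < waveK ν b :=
  Real.sqrt_pos.2 (by positivity)

lemma twProfile_pos (ν b x : ℝ) : 0 < twProfile ν b x := by
  unfold twProfile; positivity

lemma twProfile_lt_one (ν b x : ℝ) : twProfile ν b x < 1 := by
  unfold twProfile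
  exact inv_lt_one_of_one_lt₀ (by linarith [Real.exp_pos (-(waveK ν b) * x)])

lemma twProfile_zero (ν b : ℝ) : twProfile ν b 0 = 1 / 2 := by
  unfold twProfile; norm_num

lemma hasDerivAt_twProfile (ν b x : ℝ) : HasDerivAt (twProfile ν b) (twW ν b x) x := by
  have h1 : HasDerivAt (fun y ↦ 1 + Real.exp (-(waveK ν b) * y))
      (Real.exp (-(waveK ν b) * x) * (-(waveK ν b) * 1)) x :=
    (((hasDerivAt_id x).const_mul (-(waveK ν b))).exp).const_add 1
  have hpos : 0 < 1 + Real.exp (-(waveK ν b) * x) := by positivity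
  refine (h1.inv hpos.ne').congr_deriv ?_
  unfold twW twProfile
  field_simp
  ring

lemma continuous_twProfile (ν b : ℝ) : Continuous (twProfile ν b) :=
  continuous_iff_continuousAt.2 fun x ↦ (hasDerivAt_twProfile ν b x).continuousAt

lemma continuous_twW (ν b : ℝ) : Continuous (twW ν b) := by
  have := continuous_twProfile ν b
  unfold twW
  fun_prop

lemma twW_pos (hν : 0 < ν) (hb : 0 < b) (x : ℝ) : 0 < twW ν b x :=
  mul_pos (mul_pos (waveK_pos hν hb) (twProfile_pos ν b x))
    (sub_pos.2 (twProfile_lt_one ν b x))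

lemma twW_le_waveK (hν : 0 < ν) (hb : 0 < b) (x : ℝ) : twW ν b x ≤ waveK ν b := by
  have h0 := twProfile_pos ν b x
  have hk := waveK_pos hν hb
  have : twProfile ν b x * (1 - twProfile ν b x) ≤ 1 := by
    nlinarith [sq_nonneg (twProfile ν b x - 1 / 2)]
  unfold twW
  nlinarith

lemma strictMono_twProfile (hν : 0 < ν) (hb : 0 < b) : StrictMono (twProfile ν b) :=
  strictMono_of_hasDerivAt_pos (hasDerivAt_twProfile ν b) (twW_pos hν hb)

lemma tendsto_twProfile_atTop (hν : 0 < ν) (hb : 0 < b) :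
    Tendsto (twProfile ν b) atTop (𝓝 1) := by
  have h1 : Tendsto (fun x ↦ -(waveK ν b) * x) atTop atBot :=
    tendsto_id.const_mul_atTop_of_neg (neg_lt_zero.2 (waveK_pos hν hb))
  have h2 := ((Real.tendsto_exp_atBot.comp h1).const_add 1).inv₀ (by norm_num)
  rwa [add_zero, inv_one] at h2

lemma integrableOn_twW_sq (hν : 0 < ν) (hb : 0 < b) :
    IntegrableOn (fun x ↦ twW ν b x ^ 2) (Set.Ioi 0) := by
  have hw : IntegrableOn (twW ν b) (Set.Ioi 0) :=
    integrableOn_Ioi_deriv_of_nonneg' (fun x _ ↦ hasDerivAt_twProfile ν b x)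
      (fun x _ ↦ (twW_pos hν hb x).le) (tendsto_twProfile_atTop hν hb)
  refine (hw.const_mul (waveK ν b)).mono' ((continuous_twW ν b).pow 2).aestronglyMeasurable
    (Eventually.of_forall fun x ↦ ?_)
  rw [Real.norm_of_nonneg (sq_nonneg _), sq]
  exact mul_le_mul_of_nonneg_right (twW_le_waveK hν hb x) (twW_pos hν hb x).le

lemma integrableOn_sq_mul_twW_sq (hν : 0 < ν) (hb : 0 < b) {f : ℝ → ℝ} {M : ℝ}
    (hf : ContinuousOn f (Set.Ici 0)) (hM : ∀ x ∈ Set.Ici (0 : ℝ), |f x| ≤ M) :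
    IntegrableOn (fun x ↦ f x ^ 2 * twW ν b x ^ 2) (Set.Ioi 0) := by
  refine ((integrableOn_twW_sq hν hb).const_mul (M ^ 2)).mono' ?_ ?_
  · exact (((hf.mono Set.Ioi_subset_Ici_self).pow 2).mul
      ((continuous_twW ν b).pow 2).continuousOn).aestronglyMeasurable measurableSet_Ioi
  · filter_upwards [ae_restrict_mem measurableSet_Ioi] with x hx
    rw [Real.norm_of_nonneg (by positivity)]
    have := hM x (Set.mem_Ici.2 (le_of_lt hx))
    exact mul_le_mul_of_nonneg_right (sq_le_sq' (abs_le.1 this).1 (abs_le.1 this).2) (sq_nonneg _)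

/-- The function `w''/(k² w) = 1 - 6 v (1 - v)`, whose only zero on `[0, ∞)` is `x*`. -/
noncomputable def twPsi (ν b x : ℝ) : ℝ :=
  1 - 6 * (twProfile ν b x * (1 - twProfile ν b x))

/-- The flux `w² φ'/φ` of the Neumann eigenfunction `φ = (1 - 6 v (1 - v)) / (v (1 - v))`. -/
noncomputable def twFlux (ν b x : ℝ) : ℝ :=
  waveK ν b * (2 * twProfile ν b x - 1) * twW ν b x ^ 2 / twPsi ν b x

lemma hasDerivAt_twPsi (ν b x : ℝ) :
    HasDerivAt (twPsi ν b) (6 * twW ν b x * (2 * twProfile ν b x - 1)) x := by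
  have hv := hasDerivAt_twProfile ν b x
  refine (((hv.mul (hv.const_sub 1)).const_mul 6).const_sub 1).congr_deriv ?_
  ring

lemma hasDerivAt_twW (ν b x : ℝ) :
    HasDerivAt (twW ν b) (waveK ν b * twW ν b x * (1 - 2 * twProfile ν b x)) x := by
  have hv := hasDerivAt_twProfile ν b x
  refine ((hv.const_mul (waveK ν b)).mul (hv.const_sub 1)).congr_deriv ?_
  ring

/-- The Riccati equation satisfied by the logarithmic derivative of `φ`. -/
lemma hasDerivAt_twFlux {x : ℝ} (hx : twPsi ν b x ≠ 0) :
    HasDerivAt (twFlux ν b)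
      (-(waveK ν b ^ 2 + (waveK ν b * (2 * twProfile ν b x - 1) / twPsi ν b x) ^ 2)
        * twW ν b x ^ 2) x := by
  have hv := hasDerivAt_twProfile ν b x
  refine (((((hv.const_mul 2).sub_const 1).const_mul (waveK ν b)).mul
    ((hasDerivAt_twW ν b x).pow 2)).div (hasDerivAt_twPsi ν b x) hx).congr_deriv ?_
  simp only [Pi.pow_apply, Pi.mul_apply]
  field_simp
  simp only [twPsi, twW]
  ring

lemma twFlux_zero (ν b : ℝ) : twFlux ν b 0 = 0 := by
  simp [twFlux, twProfile_zero]

lemma tendsto_twFlux_atTop (hν : 0 < ν) (hb : 0 < b) :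
    Tendsto (twFlux ν b) atTop (𝓝 0) := by
  have hv := tendsto_twProfile_atTop hν hb
  have hw : Tendsto (twW ν b) atTop (𝓝 (waveK ν b * 1 * (1 - 1))) :=
    (hv.const_mul _).mul (hv.const_sub 1)
  have hψ : Tendsto (twPsi ν b) atTop (𝓝 (1 - 6 * (1 * (1 - 1)))) :=
    ((hv.mul (hv.const_sub 1)).const_mul 6).const_sub 1
  have hlim := ((((hv.const_mul 2).sub_const 1).const_mul (waveK ν b)).mul
    (hw.pow 2)).div hψ (by norm_num)
  rwa [sub_self, mul_zero, zero_pow two_ne_zero, mul_zero, zero_div] at hlim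

lemma twPsi_eq_zero_iff (hν : 0 < ν) (hb : 0 < b) {xstar x : ℝ}
    (hxstar : twProfile ν b xstar = 1 / 2 + 1 / (2 * Real.sqrt 3)) (hx : 0 ≤ x) :
    twPsi ν b x = 0 ↔ x = xstar := by
  have h3 : (1 / (2 * Real.sqrt 3)) ^ 2 = 1 / 12 := by
    rw [div_pow, mul_pow, Real.sq_sqrt (by norm_num)]; norm_num
  have h3' : 0 < 1 / (2 * Real.sqrt 3) := by positivity
  constructor
  · intro h
    refine (strictMono_twProfile hν hb).injective ?_
    have hge := (strictMono_twProfile hν hb).monotone hx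
    rw [twProfile_zero] at hge
    have : (twProfile ν b x - 1 / 2) ^ 2 = (1 / (2 * Real.sqrt 3)) ^ 2 := by
      unfold twPsi at h; rw [h3]; linarith
    have := (sq_eq_sq₀ (by linarith) h3'.le).1 this
    linarith
  · rintro rfl
    unfold twPsi
    rw [hxstar]
    linarith

/-- A double zero of `f²` compensates the simple pole of the flux. -/
lemma continuousAt_sq_mul_twFlux (hν : 0 < ν) (hb : 0 < b) {f : ℝ → ℝ} {f' x₀ : ℝ}
    (hx₀ : 0 < x₀) (hψ : twPsi ν b x₀ = 0) (hf : HasDerivAt f f' x₀) (hf₀ : f x₀ = 0) :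
    ContinuousAt (fun x ↦ f x ^ 2 * twFlux ν b x) x₀ := by
  have hv₀ := strictMono_twProfile hν hb hx₀
  rw [twProfile_zero] at hv₀
  have hd : 6 * twW ν b x₀ * (2 * twProfile ν b x₀ - 1) ≠ 0 :=
    (mul_pos (mul_pos (by norm_num) (twW_pos hν hb x₀)) (by linarith)).ne'
  rw [continuousAt_iff_punctured_nhds]
  have hnum : Continuous fun x ↦ waveK ν b * (2 * twProfile ν b x - 1) * twW ν b x ^ 2 := by
    have := continuous_twProfile ν b
    have := continuous_twW ν b
    fun_prop
  have hlim := ((hf.continuousAt.tendsto.mono_left nhdsWithin_le_nhds).mul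
    ((hasDerivAt_iff_tendsto_slope.1 hf).div
      (hasDerivAt_iff_tendsto_slope.1 (hasDerivAt_twPsi ν b x₀)) hd)).mul
    ((hnum.tendsto x₀).mono_left nhdsWithin_le_nhds)
  simp only [hf₀, zero_mul, zero_pow two_ne_zero] at hlim ⊢
  refine hlim.congr' ?_
  filter_upwards [self_mem_nhdsWithin] with x hx
  have hx' : x - x₀ ≠ 0 := sub_ne_zero.2 hx
  simp only [slope_def_field, hf₀, hψ, sub_zero, twFlux, Pi.div_apply]
  rw [div_div_div_cancel_right₀ hx']
  ring

end TravellingWave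

/-- let `v* = 1/2 + 1/(2√3)` and `x* > 0` with `v(x*) = v*`. Then
for every bounded `C¹` function `h : [0,∞) → ℝ` with bounded derivative,
`∫_0^∞ (h - h(x*))² w² ≤ (1/k²) ∫_0^∞ (h')² w²`. -/
theorem half_line_poincare_centered
    (ν b a : ℝ) (hν : 0 < ν) (hb : 0 < b) (ha : a ∈ Set.Ioo (0 : ℝ) 1)
    (xstar : ℝ) (hxstar_pos : 0 < xstar)
    (hxstar : twProfile ν b xstar = 1 / 2 + 1 / (2 * Real.sqrt 3))
    (h : ℝ → ℝ) (hh : ContDiffOn ℝ 1 h (Set.Ici 0))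
    (hbdd : ∃ M : ℝ, ∀ x ∈ Set.Ici (0 : ℝ), |h x| ≤ M)
    (hbdd' : ∃ M : ℝ, ∀ x ∈ Set.Ici (0 : ℝ), |derivWithin h (Set.Ici 0) x| ≤ M) :
    ∫ x in Set.Ioi (0 : ℝ), (h x - h xstar) ^ 2 * (twW ν b x) ^ 2
    ≤ (1 / waveK ν b ^ 2)
        * ∫ x in Set.Ioi (0 : ℝ), (derivWithin h (Set.Ici 0) x) ^ 2 * (twW ν b x) ^ 2 := by
  obtain ⟨M, hM⟩ := hbdd
  obtain ⟨M', hM'⟩ := hbdd'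
  have hk := waveK_pos hν hb
  set k := waveK ν b with hkdef
  set f : ℝ → ℝ := fun x ↦ h x - h xstar
  set f' : ℝ → ℝ := derivWithin h (Set.Ici 0)
  have hfc : ContinuousOn f (Set.Ici 0) := hh.continuousOn.sub continuousOn_const
  have hf'c : ContinuousOn f' (Set.Ici 0) :=
    hh.continuousOn_derivWithin (uniqueDiffOn_Ici 0) le_rfl
  have hfM : ∀ x ∈ Set.Ici (0 : ℝ), |f x| ≤ M + M := fun x hx ↦
    (abs_sub _ _).trans (add_le_add (hM x hx) (hM xstar hxstar_pos.le))
  have hfd : ∀ x, 0 < x → HasDerivAt f (f' x) x := fun x hx ↦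
    (((hh.differentiableOn one_ne_zero x hx.le).hasDerivWithinAt).hasDerivAt
      (Ici_mem_nhds hx)).sub_const _
  have hfi := integrableOn_sq_mul_twW_sq hν hb hfc hfM
  have hf'i := integrableOn_sq_mul_twW_sq hν hb hf'c hM'
  have hψ : ∀ x, 0 ≤ x → (twPsi ν b x = 0 ↔ x = xstar) := fun x hx ↦
    twPsi_eq_zero_iff hν hb hxstar hx
  set D : ℝ → ℝ := fun x ↦ f' x ^ 2 * twW ν b x ^ 2 - k ^ 2 * (f x ^ 2 * twW ν b x ^ 2) with hD
  have hDi : IntegrableOn D (Set.Ioi 0) := hf'i.sub (hfi.const_mul _)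
  have hDc : ContinuousOn D (Set.Ici 0) := by
    have := (continuous_twW ν b).continuousOn (s := Set.Ici 0)
    exact ((hf'c.pow 2).mul (this.pow 2)).sub (((hfc.pow 2).mul (this.pow 2)).const_mul _)
  set G : ℝ → ℝ := fun x ↦ f x ^ 2 * twFlux ν b x with hG
  have hGc : ContinuousOn G (Set.Ici 0) := by
    intro x hx
    by_cases hxs : x = xstar
    · subst hxs
      exact (continuousAt_sq_mul_twFlux hν hb hxstar_pos ((hψ x hx).2 rfl)
        (hfd x hxstar_pos) (sub_self _)).continuousWithinAt
    · exact ((hfc x hx).pow 2).mul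
        (hasDerivAt_twFlux (mt (hψ x hx).1 hxs)).continuousAt.continuousWithinAt
  have hstep : ∀ c d, 0 ≤ c → c ≤ d → xstar ∉ Set.Ioo c d → G d - G c ≤ ∫ x in c..d, D x := by
    intro c d hc hcd hnot
    have hsub : Set.Icc c d ⊆ Set.Ici 0 := fun x hx ↦ hc.trans hx.1
    refine intervalIntegral.sub_le_integral_of_hasDeriv_right_of_le hcd (hGc.mono hsub)
      (fun x hx ↦ (((hfd x (hc.trans_lt hx.1)).pow 2).mul (hasDerivAt_twFlux
        (mt (hψ x (hc.trans hx.1.le)).1 fun e ↦ hnot (e ▸ hx)))).hasDerivWithinAt)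
      ((hDc.mono hsub).integrableOn_Icc) (fun x hx ↦ ?_)
    have hp : twPsi ν b x ≠ 0 := mt (hψ x (hc.trans hx.1.le)).1 fun e ↦ hnot (e ▸ hx)
    have key := sq_nonneg
      ((f' x - k * (2 * twProfile ν b x - 1) / twPsi ν b x * f x) * twW ν b x)
    rw [← sub_nonneg]
    refine key.trans_eq ?_
    simp only [hD, twFlux, Pi.pow_apply, ← hkdef]
    field_simp
    ring
  have hle : ∀ R, xstar ≤ R → G R ≤ ∫ x in (0 : ℝ)..R, D x := by
    intro R hR
    have hint : ∀ c d, 0 ≤ c → c ≤ d → IntervalIntegrable D volume c d := fun c d hc hcd ↦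
      (hDc.mono fun x hx ↦ hc.trans (by rw [Set.uIcc_of_le hcd] at hx; exact hx.1))
        |>.intervalIntegrable
    rw [← intervalIntegral.integral_add_adjacent_intervals
      (hint 0 xstar le_rfl hxstar_pos.le) (hint xstar R hxstar_pos.le hR)]
    have h1 := hstep 0 xstar le_rfl hxstar_pos.le (by simp)
    have h2 := hstep xstar R hxstar_pos.le hR (by simp)
    have h0 : G 0 = 0 := by simp [hG, twFlux_zero]
    linarith
  have hGlim : Tendsto G atTop (𝓝 0) := by
    refine bdd_le_mul_tendsto_zero' ((M + M) ^ 2) ?_ (tendsto_twFlux_atTop hν hb)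
    filter_upwards [eventually_ge_atTop 0] with x hx
    rw [abs_pow]
    exact pow_le_pow_left₀ (abs_nonneg _) (hfM x hx) 2
  have hmain : 0 ≤ ∫ x in Set.Ioi (0 : ℝ), D x :=
    le_of_tendsto_of_tendsto hGlim (intervalIntegral_tendsto_integral_Ioi 0 hDi tendsto_id)
      ((eventually_ge_atTop xstar).mono hle)
  rw [hD, integral_sub hf'i (hfi.const_mul _), integral_const_mul] at hmain
  rw [one_div_mul_eq_div, le_div_iff₀ (by positivity)]
  linarith
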